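/- arXiv:1108.5343 — 2 statements merged into one kernel-verified Lean document; each statement's English description precedes it below -/
import Mathlib

section
/- Let n ≥ 2, l ∈ ℕ₀, 0 < p < ∞, 0 < q < ∞ and α > 0 with p(n−1+l) > n + αp. There is a constant C > 0 such that for every w = (y,s) ∈ ℝ^{n+1}_+: ‖f_{w,l}‖_{B_α^{q,p}} = (∫_0^∞ M_p(f_{w,l}, t)^q t^{αq−1} dt)^{1/q} ≤ C s^{n/p − (n−1+l) + α}. -/
open MeasureTheory Real Set
open scoped ENNReal

noncomputable section

abbrev Euc (N : ℕ) : Type := EuclideanSpace ℝ (Fin N)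

/-- The point `(x, t) ∈ ℝ^{n+1}`. -/
def pt {n : ℕ} (x : Euc n) (t : ℝ) : Euc (n + 1) :=
  (EuclideanSpace.equiv (Fin (n + 1)) ℝ).symm (Fin.snoc (fun i => x i) t)

/-- horizontal part of a point of ℝ^{n+1} -/
def xp {n : ℕ} (z : Euc (n + 1)) : Euc n :=
  (EuclideanSpace.equiv (Fin n) ℝ).symm (fun i => z i.castSucc)

/-- vertical part of a point of ℝ^{n+1} -/
def tp {n : ℕ} (z : Euc (n + 1)) : ℝ := z (Fin.last n)

/-- The upper half space ℝ^{n+1}_+. -/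
def upperHS (n : ℕ) : Set (Euc (n + 1)) := {z | 0 < tp z}

/-- |z - w̄| where z = (x,t), w̄ = (y, -s): Euclidean distance -/
def dB {n : ℕ} (x : Euc n) (t : ℝ) (y : Euc n) (s : ℝ) : ℝ :=
  dist (pt x t) (pt y (-s))

/-- the measure t^λ dx dt on ℝ^n × (0,∞), identified with ℝ^{n+1}_+ -/
def mLam (n : ℕ) (l : ℝ) : Measure (Euc n × ℝ) :=
  ((volume : Measure (Euc n)).prod ((volume : Measure ℝ).restrict (Ioi 0))).withDensity
    (fun zt => ENNReal.ofReal (zt.2 ^ l))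

/-- second derivative of `f` at `z` along direction `v` -/
def d2 {V : Type*} [NormedAddCommGroup V] [NormedSpace ℝ V] (f : V → ℝ) (z v : V) : ℝ :=
  iteratedFDeriv ℝ 2 f z ![v, v]

/-- `f` is harmonic on a subset of ℝ^N : twice continuously differentiable with
vanishing Laplacian. -/
def HarmonicOnE {N : ℕ} (f : Euc N → ℝ) (s : Set (Euc N)) : Prop :=
  ContDiffOn ℝ 2 f s ∧ ∀ z ∈ s, ∑ i, d2 f z (EuclideanSpace.single i 1) = 0

/-- `f` is harmonic on (ℝ^{n+1}_+)^m, viewed as an open subset of ℝ^{m(n+1)}. -/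
def HarmonicOnM {n m : ℕ} (f : (Fin m → Euc (n + 1)) → ℝ) : Prop :=
  ContDiffOn ℝ 2 f {z | ∀ j, z j ∈ upperHS n} ∧
  ∀ z ∈ {z : Fin m → Euc (n + 1) | ∀ j, z j ∈ upperHS n},
    ∑ j, ∑ i, d2 f z (Function.update (0 : Fin m → Euc (n + 1)) j (EuclideanSpace.single i 1)) = 0

/-- `f` is harmonic in each variable separately on (ℝ^{n+1}_+)^m -/
def HarmonicSep {n m : ℕ} (f : (Fin m → Euc (n + 1)) → ℝ) : Prop :=
  ∀ (j : Fin m) (z : Fin m → Euc (n + 1)), (∀ k, z k ∈ upperHS n) →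
    HarmonicOnE (fun w => f (Function.update z j w)) (upperHS n)

/-- the closed cube centered at (y,s) with side length s -/
def Qcube {n : ℕ} (y : Euc n) (s : ℝ) : Set (Euc (n + 1)) :=
  {z | (∀ i : Fin n, |z (Fin.castSucc i) - y i| ≤ s / 2) ∧ |tp z - s| ≤ s / 2}

/-- the A^p_λ (quasi)-norm, raised to the power p -/
def normAp (n : ℕ) (f : Euc (n + 1) → ℝ) (p l : ℝ) : ℝ≥0∞ :=
  ∫⁻ zt : Euc n × ℝ, ENNReal.ofReal (|f (pt zt.1 zt.2)| ^ p) ∂(mLam n l)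

/-- membership in the harmonic Bergman space A^p_λ -/
def memAp (n : ℕ) (f : Euc (n + 1) → ℝ) (p l : ℝ) : Prop :=
  HarmonicOnE f (upperHS n) ∧ normAp n f p l < ⊤


/-- f_{w,l}(z) = ∂^l/∂t^l (|z - w̄|^{1-n}) for w = (y,s), z = (x,t) -/
def fwl (n l : ℕ) (y : Euc n) (s : ℝ) (x : Euc n) (t : ℝ) : ℝ :=
  iteratedDeriv l (fun τ => dB x τ y s ^ (1 - (n : ℝ))) t

/-- M_p(f_{w,l}, t) -/
def MpFwl (n l : ℕ) (y : Euc n) (s : ℝ) (p t : ℝ) : ℝ≥0∞ :=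
  (∫⁻ x : Euc n, ENNReal.ofReal (|fwl n l y s x t| ^ p)) ^ (1 / p)

/-- The derivatives of `v ↦ v ^ j * (b + v ^ 2) ^ β` on the positive half-line are bounded by the
power of `b + v ^ 2` of the same homogeneity, uniformly in `b ≥ 0`. -/
lemma exists_abs_iteratedDeriv_pow_mul_rpow_le (l j : ℕ) (β : ℝ) :
    ∃ C : ℝ, 0 ≤ C ∧ ∀ b u : ℝ, 0 ≤ b → 0 < u →
      |iteratedDeriv l (fun v : ℝ => v ^ j * (b + v ^ 2) ^ β) u| ≤
        C * (b + u ^ 2) ^ (β + ((j : ℝ) - l) / 2) := by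
  induction l generalizing j β with
  | zero =>
    refine ⟨1, zero_le_one, fun b u hb hu => ?_⟩
    have hpos : 0 < b + u ^ 2 := by positivity
    have hu' : u ≤ (b + u ^ 2) ^ ((1 : ℝ) / 2) := by
      rw [← Real.sqrt_eq_rpow]
      exact Real.le_sqrt_of_sq_le (by linarith)
    rw [iteratedDeriv_zero, abs_of_pos (by positivity), one_mul, add_comm β,
      Real.rpow_add hpos]
    refine mul_le_mul_of_nonneg_right ?_ (by positivity)
    calc u ^ j ≤ ((b + u ^ 2) ^ ((1 : ℝ) / 2)) ^ j := pow_le_pow_left₀ hu.le hu' j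
      _ = (b + u ^ 2) ^ (((j : ℝ) - (0 : ℕ)) / 2) := by
        rw [← Real.rpow_natCast, ← Real.rpow_mul hpos.le]
        congr 1
        push_cast
        ring
  | succ l ih =>
    obtain ⟨C₁, hC₁, h₁⟩ := ih (j - 1) β
    obtain ⟨C₂, hC₂, h₂⟩ := ih (j + 1) (β - 1)
    refine ⟨j * C₁ + |2 * β| * C₂, by positivity, fun b u hb hu => ?_⟩
    have hsmooth : ∀ (k : ℕ) (γ : ℝ),
        ContDiffAt ℝ l (fun v : ℝ => v ^ k * (b + v ^ 2) ^ γ) u := fun k γ =>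
      (contDiffAt_id.pow k).mul
        ((contDiffAt_const.add (contDiffAt_id.pow 2)).rpow_const_of_ne
          (ne_of_gt (by simp only [id]; positivity)))
    have hderiv : deriv (fun v : ℝ => v ^ j * (b + v ^ 2) ^ β) =ᶠ[nhds u]
        fun v => (j : ℝ) * (v ^ (j - 1) * (b + v ^ 2) ^ β) +
          (2 * β) * (v ^ (j + 1) * (b + v ^ 2) ^ (β - 1)) := by
      filter_upwards [lt_mem_nhds hu] with v hv
      have hpos : 0 < b + v ^ 2 := by positivity
      have h : HasDerivAt (fun v : ℝ => b + v ^ 2) (2 * v) v := by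
        simpa using (hasDerivAt_pow 2 v).const_add b
      refine ((hasDerivAt_pow j v).mul
        (h.rpow_const (p := β) (Or.inl hpos.ne'))).deriv.trans ?_
      ring
    rw [iteratedDeriv_succ', hderiv.iteratedDeriv_eq,
      iteratedDeriv_fun_add (contDiffAt_const.mul (hsmooth _ _))
        (contDiffAt_const.mul (hsmooth _ _)),
      iteratedDeriv_const_mul_field, iteratedDeriv_const_mul_field, add_mul]
    refine (abs_add_le _ _).trans (add_le_add ?_ ?_)
    · rcases Nat.eq_zero_or_pos j with rfl | hj
      · simp
      · rw [abs_mul, Nat.abs_cast, mul_assoc]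
        refine mul_le_mul_of_nonneg_left ((h₁ b u hb hu).trans_eq ?_) (by positivity)
        rw [Nat.cast_sub hj]
        congr 2
        push_cast
        ring
    · rw [abs_mul, mul_assoc]
      refine mul_le_mul_of_nonneg_left ((h₂ b u hb hu).trans_eq ?_) (by positivity)
      congr 2
      push_cast
      ring

lemma dB_eq_sqrt {n : ℕ} (x y : Euc n) (t s : ℝ) :
    dB x t y s = √(‖x - y‖ ^ 2 + (t + s) ^ 2) := by
  rw [dB, EuclideanSpace.dist_eq, Fin.sum_univ_castSucc, EuclideanSpace.norm_sq_eq]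
  simp [pt, Real.dist_eq, sq_abs]

lemma fwl_eq_iteratedDeriv (n l : ℕ) (x y : Euc n) (t s : ℝ) :
    fwl n l y s x t =
      iteratedDeriv l (fun v : ℝ => (‖x - y‖ ^ 2 + v ^ 2) ^ ((1 - (n : ℝ)) / 2)) (t + s) := by
  have h : (fun τ => dB x τ y s ^ (1 - (n : ℝ))) =
      fun τ => (fun v : ℝ => (‖x - y‖ ^ 2 + v ^ 2) ^ ((1 - (n : ℝ)) / 2)) (τ + s) := by
    funext τ
    rw [dB_eq_sqrt, Real.sqrt_eq_rpow, ← Real.rpow_mul (by positivity)]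
    congr 1
    ring
  rw [fwl, h]
  exact congrFun (iteratedDeriv_comp_add_const l
    (fun v : ℝ => (‖x - y‖ ^ 2 + v ^ 2) ^ ((1 - (n : ℝ)) / 2)) s) t

lemma exists_abs_fwl_le (n l : ℕ) :
    ∃ C : ℝ, 0 ≤ C ∧ ∀ (x y : Euc n) (t s : ℝ), 0 < t + s →
      |fwl n l y s x t| ≤
        C * (‖x - y‖ ^ 2 + (t + s) ^ 2) ^ (-((n : ℝ) - 1 + l) / 2) := by
  obtain ⟨C, hC, h⟩ := exists_abs_iteratedDeriv_pow_mul_rpow_le l 0 ((1 - (n : ℝ)) / 2)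
  refine ⟨C, hC, fun x y t s hts => ?_⟩
  rw [fwl_eq_iteratedDeriv]
  convert h (‖x - y‖ ^ 2) (t + s) (by positivity) hts using 3
  · simp
  · push_cast
    ring

open Module in
lemma lintegral_comp_smul_eq {E : Type*} [NormedAddCommGroup E] [NormedSpace ℝ E]
    [MeasurableSpace E] [BorelSpace E] [FiniteDimensional ℝ E] (μ : Measure E)
    [μ.IsAddHaarMeasure] {f : E → ℝ≥0∞} (hf : Measurable f) {r : ℝ} (hr : r ≠ 0) :
    ∫⁻ x, f (r • x) ∂μ = ENNReal.ofReal |(r ^ finrank ℝ E)⁻¹| * ∫⁻ x, f x ∂μ := by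
  rw [← lintegral_map hf (measurable_const_smul r), Measure.map_addHaar_smul μ hr,
    lintegral_smul_measure, smul_eq_mul]

/-- Scaling of the integral of a power of `|z - w̄|` over a horizontal hyperplane. -/
lemma lintegral_norm_sub_sq_add_sq_rpow {n : ℕ} (y : Euc n) {r : ℝ} (hr : 0 < r) (e : ℝ) :
    ∫⁻ x : Euc n, ENNReal.ofReal ((‖x - y‖ ^ 2 + r ^ 2) ^ (-e / 2)) =
      ENNReal.ofReal (r ^ ((n : ℝ) - e)) *
        ∫⁻ x : Euc n, ENNReal.ofReal ((1 + ‖x‖ ^ 2) ^ (-e / 2)) := by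
  rw [lintegral_sub_right_eq_self
    (fun x : Euc n => ENNReal.ofReal ((‖x‖ ^ 2 + r ^ 2) ^ (-e / 2))) y]
  have hscale : ∀ x : Euc n, ENNReal.ofReal ((‖x‖ ^ 2 + r ^ 2) ^ (-e / 2)) =
      ENNReal.ofReal (r ^ (-e)) * ENNReal.ofReal ((1 + ‖r⁻¹ • x‖ ^ 2) ^ (-e / 2)) := by
    intro x
    have h : ‖x‖ ^ 2 + r ^ 2 = r ^ 2 * (1 + ‖r⁻¹ • x‖ ^ 2) := by
      rw [norm_smul, Real.norm_of_nonneg (by positivity)]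
      field_simp
      ring
    rw [← ENNReal.ofReal_mul (by positivity), h, Real.mul_rpow (by positivity) (by positivity),
      ← Real.rpow_natCast r 2, ← Real.rpow_mul hr.le]
    congr 3
    push_cast
    ring
  simp_rw [hscale]
  rw [lintegral_const_mul _ (by fun_prop),
    lintegral_comp_smul_eq volume
      (f := fun x : Euc n => ENNReal.ofReal ((1 + ‖x‖ ^ 2) ^ (-e / 2))) (by fun_prop)
      (inv_ne_zero hr.ne'), ← mul_assoc, ← ENNReal.ofReal_mul (by positivity)]
  congr 2
  rw [finrank_euclideanSpace_fin, abs_of_pos (by positivity), inv_pow, inv_inv,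
    ← Real.rpow_natCast, ← Real.rpow_add hr]
  congr 1
  ring

lemma exists_MpFwl_le (n l : ℕ) {p : ℝ} (hp : 0 < p) (hpl : (n : ℝ) < p * ((n : ℝ) - 1 + l)) :
    ∃ K : ℝ, 0 ≤ K ∧ ∀ (y : Euc n) (s t : ℝ), 0 < t + s →
      MpFwl n l y s p t ≤
        ENNReal.ofReal (K * (t + s) ^ ((n : ℝ) / p - ((n : ℝ) - 1 + l))) := by
  obtain ⟨C, hC, hbound⟩ := exists_abs_fwl_le n l
  set N : ℝ := (n : ℝ) - 1 + l with hN
  have hint : Integrable (fun x : Euc n => ((1 : ℝ) + ‖x‖ ^ 2) ^ (-(p * N) / 2)) :=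
    integrable_rpow_neg_one_add_norm_sq (by simpa using hpl)
  set J : ℝ := ∫ x : Euc n, ((1 : ℝ) + ‖x‖ ^ 2) ^ (-(p * N) / 2) with hJ
  have hJ0 : 0 ≤ J := integral_nonneg fun x => by positivity
  have hJeq : ∫⁻ x : Euc n, ENNReal.ofReal ((1 + ‖x‖ ^ 2) ^ (-(p * N) / 2)) =
      ENNReal.ofReal J :=
    (ofReal_integral_eq_lintegral_ofReal hint (ae_of_all _ fun x => by positivity)).symm
  refine ⟨(C ^ p * J) ^ (1 / p), by positivity, fun y s t hts => ?_⟩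
  have hpow : ∫⁻ x : Euc n, ENNReal.ofReal (|fwl n l y s x t| ^ p) ≤
      ENNReal.ofReal ((C ^ p * J) * (t + s) ^ ((n : ℝ) - p * N)) := by
    calc ∫⁻ x : Euc n, ENNReal.ofReal (|fwl n l y s x t| ^ p)
        ≤ ∫⁻ x : Euc n, ENNReal.ofReal (C ^ p) *
            ENNReal.ofReal ((‖x - y‖ ^ 2 + (t + s) ^ 2) ^ (-(p * N) / 2)) := by
          refine lintegral_mono fun x => ?_
          rw [← ENNReal.ofReal_mul (by positivity)]
          refine ENNReal.ofReal_le_ofReal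
            ((Real.rpow_le_rpow (abs_nonneg _) (hbound x y t s hts) hp.le).trans_eq ?_)
          rw [Real.mul_rpow hC (by positivity), ← Real.rpow_mul (by positivity)]
          congr 2
          ring
      _ = ENNReal.ofReal ((C ^ p * J) * (t + s) ^ ((n : ℝ) - p * N)) := by
          rw [lintegral_const_mul _ (by fun_prop), lintegral_norm_sub_sq_add_sq_rpow y hts, hJeq,
            ← ENNReal.ofReal_mul (by positivity), ← ENNReal.ofReal_mul (by positivity)]
          congr 1
          ring
  refine (ENNReal.rpow_le_rpow hpow (by positivity)).trans_eq ?_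
  rw [ENNReal.ofReal_rpow_of_nonneg (by positivity) (by positivity),
    Real.mul_rpow (by positivity) (by positivity), ← Real.rpow_mul hts.le]
  congr 3
  field_simp

lemma lintegral_Ioi_add_rpow_mul_rpow_le {a γ s : ℝ} (ha : 0 < a) (haγ : a < γ) (hs : 0 < s) :
    ∫⁻ t in Ioi (0 : ℝ), ENNReal.ofReal ((t + s) ^ (-γ) * t ^ (a - 1)) ≤
      ENNReal.ofReal ((1 / a + 1 / (γ - a)) * s ^ (a - γ)) := by
  have hγ : 0 < γ := ha.trans haγ
  have hnear : ∫⁻ t in Ioc 0 s, ENNReal.ofReal ((t + s) ^ (-γ) * t ^ (a - 1)) ≤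
      ENNReal.ofReal (1 / a * s ^ (a - γ)) := by
    have hint : IntegrableOn (fun t : ℝ => s ^ (-γ) * t ^ (a - 1)) (Ioc 0 s) :=
      ((intervalIntegrable_iff_integrableOn_Ioc_of_le hs.le).1
        (intervalIntegral.intervalIntegrable_rpow' (by linarith))).const_mul _
    calc ∫⁻ t in Ioc 0 s, ENNReal.ofReal ((t + s) ^ (-γ) * t ^ (a - 1))
        ≤ ∫⁻ t in Ioc 0 s, ENNReal.ofReal (s ^ (-γ) * t ^ (a - 1)) := by
          refine setLIntegral_mono' measurableSet_Ioc fun t ht => ENNReal.ofReal_le_ofReal ?_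
          exact mul_le_mul_of_nonneg_right
            (Real.rpow_le_rpow_of_nonpos hs (by linarith [ht.1]) (by linarith))
            (Real.rpow_nonneg ht.1.le _)
      _ = ENNReal.ofReal (∫ t in Ioc 0 s, s ^ (-γ) * t ^ (a - 1)) := by
          refine (ofReal_integral_eq_lintegral_ofReal hint ?_).symm
          filter_upwards [ae_restrict_mem measurableSet_Ioc] with t ht
          exact mul_nonneg (by positivity) (Real.rpow_nonneg ht.1.le _)
      _ = ENNReal.ofReal (1 / a * s ^ (a - γ)) := by
          rw [integral_const_mul, ← intervalIntegral.integral_of_le hs.le,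
            integral_rpow (Or.inl (by linarith)), sub_add_cancel, Real.zero_rpow ha.ne', sub_zero,
            sub_eq_add_neg a γ, Real.rpow_add hs]
          congr 1
          ring
  have hfar : ∫⁻ t in Ioi s, ENNReal.ofReal ((t + s) ^ (-γ) * t ^ (a - 1)) ≤
      ENNReal.ofReal (1 / (γ - a) * s ^ (a - γ)) := by
    have hexp : a - γ - 1 < -1 := by linarith
    calc ∫⁻ t in Ioi s, ENNReal.ofReal ((t + s) ^ (-γ) * t ^ (a - 1))
        ≤ ∫⁻ t in Ioi s, ENNReal.ofReal (t ^ (a - γ - 1)) := by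
          refine setLIntegral_mono' measurableSet_Ioi fun t ht => ENNReal.ofReal_le_ofReal ?_
          have ht0 : 0 < t := hs.trans ht
          calc (t + s) ^ (-γ) * t ^ (a - 1) ≤ t ^ (-γ) * t ^ (a - 1) :=
                mul_le_mul_of_nonneg_right
                  (Real.rpow_le_rpow_of_nonpos ht0 (by linarith) (by linarith)) (by positivity)
            _ = t ^ (a - γ - 1) := by
                rw [← Real.rpow_add ht0]
                congr 1
                ring
      _ = ENNReal.ofReal (∫ t in Ioi s, t ^ (a - γ - 1)) := by
          refine (ofReal_integral_eq_lintegral_ofReal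
            (integrableOn_Ioi_rpow_of_lt hexp hs) ?_).symm
          filter_upwards [ae_restrict_mem measurableSet_Ioi] with t ht
          exact Real.rpow_nonneg (hs.trans ht).le _
      _ = ENNReal.ofReal (1 / (γ - a) * s ^ (a - γ)) := by
          rw [integral_Ioi_rpow_of_lt hexp hs, sub_add_cancel, ← neg_sub γ a, neg_div_neg_eq]
          congr 1
          ring
  have hpos : 0 < γ - a := by linarith
  rw [← Ioc_union_Ioi_eq_Ioi hs.le, lintegral_union measurableSet_Ioi
    (Ioc_disjoint_Ioi le_rfl), add_mul, ENNReal.ofReal_add (by positivity) (by positivity)]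
  exact add_le_add hnear hfar

/-- the estimate ‖f_{w,l}‖_{B^{q,p}_α} ≤ C s^{n/p - (n-1+l) + α}. -/
theorem stmt13 (n : ℕ) (hn : 2 ≤ n) (l : ℕ) (p q α : ℝ) (hp : 0 < p) (hq : 0 < q)
    (hα : 0 < α) (hpl : p * ((n : ℝ) - 1 + l) > n + α * p) :
    ∃ C : ℝ, 0 < C ∧ ∀ (y : Euc n) (s : ℝ), 0 < s →
      (∫⁻ t in Ioi (0 : ℝ), (MpFwl n l y s p t) ^ q * ENNReal.ofReal (t ^ (α * q - 1)))
          ^ (1 / q) ≤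
        ENNReal.ofReal (C * s ^ ((n : ℝ) / p - ((n : ℝ) - 1 + l) + α)) := by
  have hαN : α < ((n : ℝ) - 1 + l) - n / p := by
    rw [lt_sub_iff_add_lt, ← sub_pos]
    have h : ((n : ℝ) - 1 + l) - (α + n / p) = (p * ((n : ℝ) - 1 + l) - (n + α * p)) / p := by
      field_simp
      ring
    rw [h]
    exact div_pos (by linarith) hp
  obtain ⟨K, hK, hM⟩ := exists_MpFwl_le n l hp
    (lt_of_le_of_lt (le_add_of_nonneg_right (by positivity)) hpl)
  set δ : ℝ := (n : ℝ) / p - ((n : ℝ) - 1 + l) with hδ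
  have ha : 0 < α * q := by positivity
  have haγ : α * q < -(δ * q) := by nlinarith
  set D : ℝ := 1 / (α * q) + 1 / (-(δ * q) - α * q) with hD
  have hD0 : 0 < D := by
    have : 0 < -(δ * q) - α * q := by linarith
    positivity
  refine ⟨(K ^ q * D) ^ (1 / q) + 1, by positivity, fun y s hs => ?_⟩
  have hint : ∫⁻ t in Ioi (0 : ℝ), (MpFwl n l y s p t) ^ q * ENNReal.ofReal (t ^ (α * q - 1)) ≤
      ENNReal.ofReal ((K ^ q * D) * s ^ ((δ + α) * q)) := by
    calc ∫⁻ t in Ioi (0 : ℝ), (MpFwl n l y s p t) ^ q * ENNReal.ofReal (t ^ (α * q - 1))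
        ≤ ∫⁻ t in Ioi (0 : ℝ), ENNReal.ofReal (K ^ q) *
            ENNReal.ofReal ((t + s) ^ (- -(δ * q)) * t ^ (α * q - 1)) := by
          refine setLIntegral_mono' measurableSet_Ioi fun t ht => ?_
          have ht0 : 0 < t := ht
          have hts : 0 < t + s := by positivity
          refine (mul_le_mul_left (ENNReal.rpow_le_rpow (hM y s t hts) hq.le) _).trans_eq ?_
          rw [ENNReal.ofReal_rpow_of_nonneg (by positivity) hq.le,
            ← ENNReal.ofReal_mul (by positivity), ← ENNReal.ofReal_mul (by positivity),
            Real.mul_rpow hK (by positivity), ← Real.rpow_mul hts.le, neg_neg, mul_assoc]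
      _ ≤ ENNReal.ofReal (K ^ q) * ENNReal.ofReal (D * s ^ (α * q - -(δ * q))) := by
          rw [lintegral_const_mul _ (by fun_prop)]
          exact mul_le_mul_right (lintegral_Ioi_add_rpow_mul_rpow_le ha haγ hs) _
      _ = ENNReal.ofReal ((K ^ q * D) * s ^ ((δ + α) * q)) := by
          rw [← ENNReal.ofReal_mul (by positivity), ← mul_assoc]
          congr 3
          ring
  refine (ENNReal.rpow_le_rpow hint (by positivity)).trans ?_
  rw [ENNReal.ofReal_rpow_of_nonneg (by positivity) (by positivity),
    Real.mul_rpow (by positivity) (by positivity), ← Real.rpow_mul hs.le, mul_assoc,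
    mul_one_div_cancel hq.ne', mul_one]
  refine ENNReal.ofReal_le_ofReal (mul_le_mul_of_nonneg_right ?_ (by positivity))
  linarith

end
end

section
/- Let n ≥ 2, l ∈ ℕ₀, 0 < p < ∞, 0 < τ < ∞ and α > 0 with p(n−1+l) > n + αp. Then ‖f_{(0,1),l}‖_{F_α^{p,τ}} < ∞ and for every w = (y,s) ∈ ℝ^{n+1}_+ one has the exact identity ‖f_{w,l}‖_{F_α^{p,τ}}^p = s^{n − p(n−1+l−α)} · ‖f_{(0,1),l}‖_{F_α^{p,τ}}^p; more generally, for all λ > 0 and s > 0, ‖f_{(0,s),l}‖_{F_α^{p,τ}}^p = λ^{n − p(n−1+l−α)} ‖f_{(0,s/λ),l}‖_{F_α^{p,τ}}^p. -/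
open MeasureTheory Real Set
open scoped ENNReal

noncomputable section

/-- the Triebel–Lizorkin norm ‖f‖_{F^{p,q}_α} of a function f(x,t) on ℝ^{n+1}_+ -/
def normF (n : ℕ) (f : Euc n → ℝ → ℝ) (p q α : ℝ) : ℝ≥0∞ :=
  (∫⁻ x : Euc n,
    (∫⁻ t in Ioi (0 : ℝ), ENNReal.ofReal (|f x t| ^ q * t ^ (α * q - 1))) ^ (p / q))
      ^ (1 / p)

lemma dB_eq {n : ℕ} (x : Euc n) (t : ℝ) (y : Euc n) (s : ℝ) :
    dB x t y s = √(‖x - y‖ ^ 2 + (t + s) ^ 2) := by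
  rw [dB, EuclideanSpace.dist_eq, Fin.sum_univ_castSucc, EuclideanSpace.norm_sq_eq]
  simp [pt, Real.dist_eq]

lemma dB_rpow {n : ℕ} (x : Euc n) (t : ℝ) (y : Euc n) (s r : ℝ) :
    dB x t y s ^ r = (‖x - y‖ ^ 2 + (t + s) ^ 2) ^ (r / 2) := by
  rw [dB_eq, Real.sqrt_eq_rpow, ← Real.rpow_mul (by positivity)]
  congr 1
  ring

lemma dB_smul {n : ℕ} {c : ℝ} (hc : 0 < c) (x : Euc n) (t : ℝ) (y : Euc n) (s : ℝ) :
    dB (y + c • x) (c * t) y (c * s) = c * dB x t 0 s := by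
  rw [dB_eq, dB_eq, add_sub_cancel_left, norm_smul, Real.norm_of_nonneg hc.le, sub_zero,
    show (c * ‖x‖) ^ 2 + (c * t + c * s) ^ 2 = c ^ 2 * (‖x‖ ^ 2 + (t + s) ^ 2) by ring,
    Real.sqrt_mul (by positivity), Real.sqrt_sq hc.le]

lemma iteratedDeriv_comp_mul_left (l : ℕ) (c : ℝ) (g : ℝ → ℝ) (t : ℝ) :
    iteratedDeriv l (fun u => g (c * u)) t = c ^ l * iteratedDeriv l g (c * t) := by
  induction l generalizing t with
  | zero => simp
  | succ l ih =>
    rw [iteratedDeriv_succ, funext ih, deriv_const_mul_field,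
      deriv_comp_mul_left c (iteratedDeriv l g), iteratedDeriv_succ, smul_eq_mul]
    ring

lemma fwl_smul {n l : ℕ} {c : ℝ} (hc : 0 < c) (y : Euc n) (s : ℝ) (x : Euc n) (t : ℝ) :
    fwl n l y (c * s) (y + c • x) (c * t) = c ^ (1 - (n : ℝ) - l) * fwl n l 0 s x t := by
  have h := iteratedDeriv_comp_mul_left l c
    (fun u => dB (y + c • x) u y (c * s) ^ (1 - (n : ℝ))) t
  have h0 : ∀ u, 0 ≤ dB x u 0 s := fun u => by rw [dB_eq]; positivity
  simp only [dB_smul hc, Real.mul_rpow hc.le (h0 _), iteratedDeriv_const_mul_field] at h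
  rw [Real.rpow_sub hc, Real.rpow_natCast, div_mul_eq_mul_div, eq_div_iff (by positivity), fwl,
    fwl, h]
  ring

lemma lintegral_eq_mul_lintegral_comp_smul {E : Type*} [NormedAddCommGroup E] [NormedSpace ℝ E]
    [MeasurableSpace E] [BorelSpace E] [FiniteDimensional ℝ E] (μ : Measure E)
    [μ.IsAddHaarMeasure] {c : ℝ} (hc : 0 < c) (F : E → ℝ≥0∞) :
    ∫⁻ x, F x ∂μ = ENNReal.ofReal (c ^ Module.finrank ℝ E) * ∫⁻ x, F (c • x) ∂μ := by
  have h := (Homeomorph.smulOfNeZero c hc.ne').measurableEmbedding.lintegral_map (μ := μ) F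
  simp only [Homeomorph.smulOfNeZero_apply] at h
  rw [← h, Measure.map_addHaar_smul μ hc.ne', lintegral_smul_measure, smul_eq_mul, ← mul_assoc,
    ← ENNReal.ofReal_mul (by positivity), abs_of_pos (by positivity),
    mul_inv_cancel₀ (by positivity), ENNReal.ofReal_one, one_mul]

lemma lintegral_Ioi_eq_mul_lintegral_comp_mul {c : ℝ} (hc : 0 < c) (F : ℝ → ℝ≥0∞) :
    ∫⁻ t in Ioi (0 : ℝ), F t = ENNReal.ofReal c * ∫⁻ t in Ioi (0 : ℝ), F (c * t) := by
  rw [← lintegral_indicator measurableSet_Ioi, ← lintegral_indicator measurableSet_Ioi,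
    lintegral_eq_mul_lintegral_comp_smul volume hc]
  simp [Set.indicator, hc]

lemma normF_rpow {n : ℕ} (f : Euc n → ℝ → ℝ) {p : ℝ} (hp : 0 < p) (q α : ℝ) :
    normF n f p q α ^ p = ∫⁻ x : Euc n,
      (∫⁻ t in Ioi (0 : ℝ), ENNReal.ofReal (|f x t| ^ q * t ^ (α * q - 1))) ^ (p / q) := by
  rw [normF, ← ENNReal.rpow_mul, one_div_mul_cancel hp.ne', ENNReal.rpow_one]

lemma normF_fwl_smul {n l : ℕ} {p τ α c : ℝ} (hp : 0 < p) (hτ : 0 < τ) (hc : 0 < c)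
    (y : Euc n) (s : ℝ) :
    normF n (fwl n l y (c * s)) p τ α ^ p =
      ENNReal.ofReal (c ^ ((n : ℝ) - p * ((n : ℝ) - 1 + l - α))) *
        normF n (fwl n l 0 s) p τ α ^ p := by
  have hin : ∀ x : Euc n, ∫⁻ t in Ioi (0 : ℝ),
      ENNReal.ofReal (|fwl n l y (c * s) (y + c • x) t| ^ τ * t ^ (α * τ - 1)) =
      ENNReal.ofReal (c ^ (τ * (1 - (n : ℝ) - l + α))) * ∫⁻ t in Ioi (0 : ℝ),
        ENNReal.ofReal (|fwl n l 0 s x t| ^ τ * t ^ (α * τ - 1)) := by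
    intro x
    rw [lintegral_Ioi_eq_mul_lintegral_comp_mul hc,
      ← lintegral_const_mul' _ _ ENNReal.ofReal_ne_top,
      ← lintegral_const_mul' _ _ ENNReal.ofReal_ne_top]
    refine setLIntegral_congr_fun measurableSet_Ioi fun t ht => ?_
    have ht : 0 < t := ht
    rw [← ENNReal.ofReal_mul hc.le, ← ENNReal.ofReal_mul (by positivity), fwl_smul hc, abs_mul,
      abs_of_pos (by positivity : 0 < c ^ (1 - (n : ℝ) - l)),
      Real.mul_rpow (by positivity) (abs_nonneg _), Real.mul_rpow hc.le ht.le,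
      ← Real.rpow_mul hc.le]
    congr 1
    rw [show τ * (1 - (n : ℝ) - l + α) = 1 + (1 - (n : ℝ) - l) * τ + (α * τ - 1) by ring,
      Real.rpow_add hc, Real.rpow_add hc, Real.rpow_one]
    ring
  rw [normF_rpow _ hp, normF_rpow _ hp]
  refine (lintegral_add_left_eq_self _ y).symm.trans ?_
  refine (lintegral_eq_mul_lintegral_comp_smul volume hc _).trans ?_
  simp only [hin, ENNReal.mul_rpow_of_nonneg _ _ (div_pos hp hτ).le]
  rw [ENNReal.ofReal_rpow_of_pos (by positivity),
    lintegral_const_mul' _ _ ENNReal.ofReal_ne_top, ← mul_assoc,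
    ← ENNReal.ofReal_mul (by positivity), finrank_euclideanSpace_fin, ← Real.rpow_natCast,
    ← Real.rpow_mul hc.le, ← Real.rpow_add hc]
  congr 4
  field_simp
  ring

lemma exists_bound_iteratedDeriv_pow_mul_rpow (l i : ℕ) (m : ℝ) :
    ∃ C : ℝ, 0 ≤ C ∧ ∀ a u : ℝ, 0 < a →
      |iteratedDeriv l (fun v : ℝ => v ^ i * (a ^ 2 + v ^ 2) ^ m) u| ≤
        C * (a ^ 2 + u ^ 2) ^ (m + (i - l) / 2 : ℝ) := by
  induction l generalizing i m with
  | zero =>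
    refine ⟨1, zero_le_one, fun a u ha => ?_⟩
    have hD : 0 < a ^ 2 + u ^ 2 := by positivity
    rw [iteratedDeriv_zero, abs_mul, abs_of_pos (Real.rpow_pos_of_pos hD m), add_comm m,
      Real.rpow_add hD, one_mul, abs_pow]
    gcongr
    have h : |u| ≤ (a ^ 2 + u ^ 2) ^ (1 / 2 : ℝ) := by
      rw [← Real.sqrt_eq_rpow]
      exact Real.abs_le_sqrt (by nlinarith)
    calc |u| ^ i ≤ ((a ^ 2 + u ^ 2) ^ (1 / 2 : ℝ)) ^ i := by gcongr
      _ = _ := by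
        rw [← Real.rpow_natCast, ← Real.rpow_mul hD.le]
        congr 1
        push_cast
        ring
  | succ l ih =>
    obtain ⟨C₁, hC₁, h₁⟩ := ih (i - 1) m
    obtain ⟨C₂, hC₂, h₂⟩ := ih (i + 1) (m - 1)
    refine ⟨i * C₁ + |2 * m| * C₂, by positivity, fun a u ha => ?_⟩
    have hD : ∀ v : ℝ, a ^ 2 + v ^ 2 ≠ 0 := fun v => by positivity
    have hderiv : deriv (fun v : ℝ => v ^ i * (a ^ 2 + v ^ 2) ^ m) = fun v : ℝ =>
        i * (v ^ (i - 1) * (a ^ 2 + v ^ 2) ^ m) +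
          2 * m * (v ^ (i + 1) * (a ^ 2 + v ^ 2) ^ (m - 1)) := by
      funext v
      have hq : HasDerivAt (fun v : ℝ => a ^ 2 + v ^ 2) (2 * v) v := by
        simpa using (hasDerivAt_pow 2 v).const_add (a ^ 2)
      rw [((hasDerivAt_pow i v).fun_mul (hq.rpow_const (Or.inl (hD v)))).deriv]
      ring
    have hsmooth : ∀ (j : ℕ) (r : ℝ),
        ContDiffAt ℝ l (fun v : ℝ => v ^ j * (a ^ 2 + v ^ 2) ^ r) u := fun j r =>
      (contDiffAt_id.pow j).mul
        ((contDiffAt_const.add (contDiffAt_id.pow 2)).rpow_const_of_ne (hD u))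
    rw [iteratedDeriv_succ', hderiv, iteratedDeriv_fun_add (contDiffAt_const.mul (hsmooth _ _))
      (contDiffAt_const.mul (hsmooth _ _)), iteratedDeriv_const_mul_field,
      iteratedDeriv_const_mul_field]
    refine (abs_add_le _ _).trans ?_
    rw [abs_mul, abs_mul (2 * m), Nat.abs_cast, add_mul, mul_assoc, mul_assoc]
    refine add_le_add ?_ ?_
    · rcases i with _ | i
      · simp
      · refine mul_le_mul_of_nonneg_left ((h₁ a u ha).trans_eq ?_) (by positivity)
        congr 2
        push_cast [Nat.add_sub_cancel]
        ring
    · refine mul_le_mul_of_nonneg_left ((h₂ a u ha).trans_eq ?_) (by positivity)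
      congr 2
      push_cast
      ring

lemma exists_bound_fwl (n l : ℕ) {β : ℝ} (hβ : 0 ≤ β) (hβ' : β ≤ (n : ℝ) - 1 + l) :
    ∃ C : ℝ, 0 ≤ C ∧ ∀ (x : Euc n) (t : ℝ), x ≠ 0 → 0 < t →
      |fwl n l 0 1 x t| ≤ C * (1 + ‖x‖) ^ (-β) * (1 + t) ^ (-((n : ℝ) - 1 + l - β)) := by
  obtain ⟨C, hC, h⟩ := exists_bound_iteratedDeriv_pow_mul_rpow l 0 ((1 - (n : ℝ)) / 2)
  refine ⟨C * (1 / 2 : ℝ) ^ (-β / 2), by positivity, fun x t hx ht => ?_⟩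
  have h := h ‖x‖ (t + 1) (norm_pos_iff.2 hx)
  have hfwl : fwl n l 0 1 x t = iteratedDeriv l
      (fun v : ℝ => v ^ 0 * (‖x‖ ^ 2 + v ^ 2) ^ ((1 - (n : ℝ)) / 2)) (t + 1) := by
    rw [fwl, ← congrFun (iteratedDeriv_comp_add_const l _ 1) t]
    simp [dB_rpow]
  rw [hfwl]
  refine h.trans ?_
  rw [mul_assoc, mul_assoc]
  refine mul_le_mul_of_nonneg_left ?_ hC
  have hx0 : 0 ≤ ‖x‖ := norm_nonneg x
  have hD : 0 < ‖x‖ ^ 2 + (t + 1) ^ 2 := by positivity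
  rw [show (1 - (n : ℝ)) / 2 + (((0 : ℕ) : ℝ) - l) / 2 =
    -β / 2 + -((n : ℝ) - 1 + l - β) / 2 by push_cast; ring, Real.rpow_add hD, ← mul_assoc]
  have hsq : ∀ {b : ℝ} (r : ℝ), 0 ≤ b → b ^ r = (b ^ 2) ^ (r / 2) := fun {b} r hb => by
    rw [← Real.rpow_natCast, ← Real.rpow_mul hb]
    congr 1
    push_cast
    ring
  rw [hsq (-β) (by positivity), hsq (-((n : ℝ) - 1 + l - β)) (by positivity : 0 ≤ 1 + t),
    ← Real.mul_rpow (by norm_num) (by positivity)]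
  refine mul_le_mul ?_ ?_ (by positivity) (by positivity)
  · exact Real.rpow_le_rpow_of_nonpos (by positivity)
      (by nlinarith [sq_nonneg (‖x‖ - 1)]) (by linarith)
  · exact Real.rpow_le_rpow_of_nonpos (by positivity) (by nlinarith) (by linarith)

lemma lintegral_Ioi_one_add_rpow_mul_rpow_lt_top {γ δ : ℝ} (hδ : 0 < δ) (hγ : δ < γ) :
    ∫⁻ t in Ioi (0 : ℝ), ENNReal.ofReal ((1 + t) ^ (-γ) * t ^ (δ - 1)) < ⊤ := by
  rw [← Ioc_union_Ioi_eq_Ioi (zero_le_one (α := ℝ)),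
    lintegral_union measurableSet_Ioi (Ioc_disjoint_Ioi le_rfl)]
  refine ENNReal.add_lt_top.2 ⟨?_, ?_⟩
  · have h : IntegrableOn (fun t : ℝ => t ^ (δ - 1)) (Ioc 0 1) :=
      (intervalIntegral.intervalIntegrable_rpow' (by linarith)).1
    refine lt_of_le_of_lt (setLIntegral_mono' measurableSet_Ioc fun t ht => ?_) h.lintegral_lt_top
    refine ENNReal.ofReal_le_ofReal (mul_le_of_le_one_left (Real.rpow_nonneg ht.1.le _) ?_)
    exact Real.rpow_le_one_of_one_le_of_nonpos (by linarith [ht.1]) (by linarith)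
  · have h : IntegrableOn (fun t : ℝ => t ^ (-γ + (δ - 1))) (Ioi 1) :=
      integrableOn_Ioi_rpow_of_lt (by linarith) one_pos
    refine lt_of_le_of_lt (setLIntegral_mono' measurableSet_Ioi fun t ht => ?_) h.lintegral_lt_top
    have ht : 0 < t := one_pos.trans ht
    rw [Real.rpow_add ht]
    refine ENNReal.ofReal_le_ofReal (mul_le_mul_of_nonneg_right ?_ (by positivity))
    exact Real.rpow_le_rpow_of_nonpos ht (by linarith) (by linarith)

lemma normF_fwl_lt_top {n l : ℕ} {p τ α : ℝ} (hn : n ≠ 0) (hp : 0 < p) (hτ : 0 < τ) (hα : 0 < α)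
    (hpl : n + α * p < p * ((n : ℝ) - 1 + l)) : normF n (fwl n l 0 1) p τ α < ⊤ := by
  obtain ⟨β, hβ₁, hβ₂⟩ : ∃ β : ℝ, (n : ℝ) / p < β ∧ β < (n : ℝ) - 1 + l - α :=
    exists_between (by rw [div_lt_iff₀ hp]; linarith)
  have hβ : 0 ≤ β := le_trans (by positivity) hβ₁.le
  obtain ⟨C, hC, hbound⟩ := exists_bound_fwl n l hβ (by linarith)
  have : NeZero n := ⟨hn⟩
  set I := ∫⁻ t in Ioi (0 : ℝ), ENNReal.ofReal
    ((1 + t) ^ (-(((n : ℝ) - 1 + l - β) * τ)) * t ^ (α * τ - 1)) with hI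
  have hI_lt : I < ⊤ := lintegral_Ioi_one_add_rpow_mul_rpow_lt_top (by positivity)
    (mul_lt_mul_of_pos_right (by linarith) hτ)
  refine ENNReal.rpow_lt_top_of_nonneg (by positivity) (ne_of_lt ?_)
  have hinner : ∀ x : Euc n, x ≠ 0 →
      (∫⁻ t in Ioi (0 : ℝ), ENNReal.ofReal (|fwl n l 0 1 x t| ^ τ * t ^ (α * τ - 1))) ^ (p / τ) ≤
        (ENNReal.ofReal (C ^ p) * I ^ (p / τ)) *
          ENNReal.ofReal ((1 + ‖x‖) ^ (-(β * p))) := by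
    intro x hx
    have hle : ∫⁻ t in Ioi (0 : ℝ), ENNReal.ofReal (|fwl n l 0 1 x t| ^ τ * t ^ (α * τ - 1)) ≤
        ENNReal.ofReal ((C * (1 + ‖x‖) ^ (-β)) ^ τ) * I := by
      rw [hI, ← lintegral_const_mul' _ _ ENNReal.ofReal_ne_top]
      refine setLIntegral_mono' measurableSet_Ioi fun t (ht : 0 < t) => ?_
      rw [← ENNReal.ofReal_mul (by positivity), ← mul_assoc, ← neg_mul,
        Real.rpow_mul (by positivity), ← Real.mul_rpow (by positivity) (by positivity)]
      gcongr
      exact hbound x t hx ht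
    refine (ENNReal.rpow_le_rpow hle (by positivity)).trans_eq ?_
    rw [ENNReal.mul_rpow_of_nonneg _ _ (by positivity),
      ENNReal.ofReal_rpow_of_nonneg (by positivity) (by positivity), ← Real.rpow_mul (by positivity),
      mul_div_cancel₀ _ hτ.ne', Real.mul_rpow hC (by positivity), ← Real.rpow_mul (by positivity),
      ENNReal.ofReal_mul (by positivity), neg_mul]
    ring
  have hae : ∀ᵐ x : Euc n, x ≠ 0 := Measure.ae_ne volume 0
  refine (lintegral_mono_ae (hae.mono hinner)).trans_lt ?_
  rw [lintegral_const_mul' _ _ (ENNReal.mul_ne_top ENNReal.ofReal_ne_top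
    (ENNReal.rpow_ne_top_of_nonneg (by positivity) hI_lt.ne))]
  refine ENNReal.mul_lt_top (ENNReal.mul_lt_top ENNReal.ofReal_lt_top
    (ENNReal.rpow_lt_top_of_nonneg (by positivity) hI_lt.ne)) (finite_integral_one_add_norm ?_)
  rw [finrank_euclideanSpace_fin]
  exact (div_lt_iff₀ hp).1 hβ₁

/-- finiteness and exact scaling identities for ‖f_{w,l}‖_{F^{p,τ}_α}. -/
theorem stmt14 (n : ℕ) (hn : 2 ≤ n) (l : ℕ) (p τ α : ℝ) (hp : 0 < p) (hτ : 0 < τ)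
    (hα : 0 < α) (hpl : p * ((n : ℝ) - 1 + l) > n + α * p) :
    normF n (fwl n l (0 : Euc n) 1) p τ α < ⊤ ∧
    (∀ (y : Euc n) (s : ℝ), 0 < s →
      (normF n (fwl n l y s) p τ α) ^ p =
        ENNReal.ofReal (s ^ ((n : ℝ) - p * ((n : ℝ) - 1 + l - α))) *
          (normF n (fwl n l (0 : Euc n) 1) p τ α) ^ p) ∧
    (∀ lam s : ℝ, 0 < lam → 0 < s →
      (normF n (fwl n l (0 : Euc n) s) p τ α) ^ p =
        ENNReal.ofReal (lam ^ ((n : ℝ) - p * ((n : ℝ) - 1 + l - α))) *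
          (normF n (fwl n l (0 : Euc n) (s / lam)) p τ α) ^ p) := by
  refine ⟨normF_fwl_lt_top (by omega) hp hτ hα hpl, fun y s hs => ?_, fun lam s hlam hs => ?_⟩
  · simpa using normF_fwl_smul (α := α) (l := l) hp hτ hs y 1
  · have h := normF_fwl_smul (α := α) (l := l) hp hτ hlam (0 : Euc n) (s / lam)
    rwa [mul_div_cancel₀ _ hlam.ne'] at h

end
end
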